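/- arXiv:1904.07549 — 7 statements merged into one kernel-verified Lean document; each statement's English description precedes it below -/
import Mathlib

section
/- Let 𝒳 and 𝒴 be complex Banach spaces, A a bounded linear operator on 𝒳, B a bounded linear operator on 𝒴. If σ(A) ∩ σ(B) = ∅, then for every bounded linear operator C : 𝒴 → 𝒳 the Sylvester equation AX − XB = C has a unique solution X among bounded linear operators from 𝒴 to 𝒳. -/
open ContinuousLinearMap

/-- Commuting elements of a complex Banach algebra with disjoint spectra have an invertible
difference. -/
theorem Commute.isUnit_sub_of_spectrum_inter_eq_empty
    {R : Type*} [NormedRing R] [NormedAlgebra ℂ R] [CompleteSpace R] {a b : R}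
    (hab : Commute a b) (h : spectrum ℂ a ∩ spectrum ℂ b = ∅) : IsUnit (a - b) := by
  let T : Set R := Set.centralizer {a, b}
  let S : Subalgebra ℂ R := Subalgebra.centralizer ℂ T
  have hST : ∀ x ∈ S, x ∈ T := by
    intro x hx
    rw [Set.mem_centralizer_iff]
    intro y hy
    refine (Subalgebra.mem_centralizer_iff ℂ).mp hx y ?_
    rw [Set.mem_centralizer_iff]
    rcases hy with rfl | rfl <;> rintro z (rfl | rfl)
    exacts [rfl, hab.symm, hab, rfl]
  have haS : a ∈ S := (Subalgebra.mem_centralizer_iff ℂ).mpr fun g hg =>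
    (Set.mem_centralizer_iff.mp hg a (by simp)).symm
  have hbS : b ∈ S := (Subalgebra.mem_centralizer_iff ℂ).mpr fun g hg =>
    (Set.mem_centralizer_iff.mp hg b (by simp)).symm
  have hunit : ∀ x : S, IsUnit (x : R) → IsUnit x := by
    rintro ⟨x, hx⟩ ⟨u, rfl⟩
    have hu : (↑u⁻¹ : R) ∈ S := (Subalgebra.mem_centralizer_iff ℂ).mpr fun g hg =>
      (Commute.units_inv_right ((Subalgebra.mem_centralizer_iff ℂ).mp hx g hg : Commute g ↑u)).eq
    exact ⟨⟨⟨u, hx⟩, ⟨_, hu⟩, Subtype.ext u.mul_inv, Subtype.ext u.inv_mul⟩, rfl⟩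
  let _ : NormedCommRing S :=
    { (inferInstance : NormedRing S) with
      mul_comm := fun x y => Subtype.ext
        ((Subalgebra.mem_centralizer_iff ℂ).mp y.2 x (hST x x.2)) }
  have hclosed : IsClosed (S : Set R) := Set.isClosed_centralizer T
  have : CompleteSpace S := hclosed.completeSpace_coe
  have hspec : ∀ (x : S) (z : ℂ), z ∈ spectrum ℂ x → z ∈ spectrum ℂ (x : R) :=
    fun x z hz hu => hz (hunit _ hu)
  by_contra hn
  have hn' : ¬ IsUnit ((⟨a, haS⟩ : S) - ⟨b, hbS⟩) := fun hu => hn (hu.map S.val)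
  obtain ⟨f, hf⟩ := WeakDual.CharacterSpace.exists_apply_eq_zero hn'
  rw [map_sub, sub_eq_zero] at hf
  have ha := hspec _ _ (AlgHom.apply_mem_spectrum f (⟨a, haS⟩ : S))
  have hb := hspec _ _ (AlgHom.apply_mem_spectrum f (⟨b, hbS⟩ : S))
  rw [← hf] at hb
  exact (h ▸ ⟨ha, hb⟩ : f (⟨a, haS⟩ : S) ∈ (∅ : Set ℂ))

/-- The operator `X ↦ A ∘ X` has spectrum contained in that of `A`. -/
theorem ContinuousLinearMap.spectrum_postcomp_subset
    {E F : Type*} [NormedAddCommGroup E] [NormedSpace ℂ E]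
    [NormedAddCommGroup F] [NormedSpace ℂ F] (A : E →L[ℂ] E) :
    spectrum ℂ (compL ℂ F E E A) ⊆ spectrum ℂ A := by
  rintro z hz ⟨u, hu⟩
  have hsub : algebraMap ℂ ((F →L[ℂ] E) →L[ℂ] (F →L[ℂ] E)) z - compL ℂ F E E A =
      compL ℂ F E E u := by
    ext X x
    simp [hu, Algebra.algebraMap_eq_smul_one]
  refine hz ?_
  rw [spectrum.mem_resolventSet_iff, hsub]
  refine ⟨⟨compL ℂ F E E u, compL ℂ F E E ↑u⁻¹, ?_, ?_⟩, rfl⟩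
  · ext X x
    exact DFunLike.congr_fun u.mul_inv (X x)
  · ext X x
    exact DFunLike.congr_fun u.inv_mul (X x)

/-- The operator `X ↦ X ∘ B` has spectrum contained in that of `B`. -/
theorem ContinuousLinearMap.spectrum_precomp_subset
    {E F : Type*} [NormedAddCommGroup E] [NormedSpace ℂ E]
    [NormedAddCommGroup F] [NormedSpace ℂ F] (B : F →L[ℂ] F) :
    spectrum ℂ ((compL ℂ F F E).flip B) ⊆ spectrum ℂ B := by
  rintro z hz ⟨u, hu⟩
  have hsub : algebraMap ℂ ((F →L[ℂ] E) →L[ℂ] (F →L[ℂ] E)) z - (compL ℂ F F E).flip B =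
      (compL ℂ F F E).flip u := by
    ext X x
    simp [hu, Algebra.algebraMap_eq_smul_one]
  refine hz ?_
  rw [spectrum.mem_resolventSet_iff, hsub]
  refine ⟨⟨(compL ℂ F F E).flip u, (compL ℂ F F E).flip ↑u⁻¹, ?_, ?_⟩, rfl⟩
  · ext X x
    exact congrArg X (DFunLike.congr_fun u.inv_mul x)
  · ext X x
    exact congrArg X (DFunLike.congr_fun u.mul_inv x)

/-- Commuting bounded operators on a complex Banach space with disjoint spectra have a bijective
difference. -/
theorem ContinuousLinearMap.bijective_sub_of_commute
    {V : Type*} [NormedAddCommGroup V] [NormedSpace ℂ V] [CompleteSpace V] {S T : V →L[ℂ] V}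
    (hST : Commute S T) (h : spectrum ℂ S ∩ spectrum ℂ T = ∅) :
    Function.Bijective (S - T) := by
  obtain ⟨u, hu⟩ := hST.isUnit_sub_of_spectrum_inter_eq_empty h
  rw [← hu]
  exact (ContinuousLinearEquiv.ofUnit u).bijective

/-- **Sylvester–Rosenblum theorem.** If the spectra of bounded operators `A` and `B` on
complex Banach spaces are disjoint, then for every bounded `C` the Sylvester equation
`A ∘ X - X ∘ B = C` has a unique bounded solution `X`. -/
theorem sylvester_rosenblum
    {E F : Type*} [NormedAddCommGroup E] [NormedSpace ℂ E] [CompleteSpace E]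
    [NormedAddCommGroup F] [NormedSpace ℂ F] [CompleteSpace F]
    (A : E →L[ℂ] E) (B : F →L[ℂ] F)
    (h : spectrum ℂ A ∩ spectrum ℂ B = ∅) :
    ∀ C : F →L[ℂ] E, ∃! X : F →L[ℂ] E, A ∘L X - X ∘L B = C := by
  have hcomm : Commute (compL ℂ F E E A) ((compL ℂ F F E).flip B) := by
    ext X x
    simp
  have hdisj : spectrum ℂ (compL ℂ F E E A) ∩ spectrum ℂ ((compL ℂ F F E).flip B) = ∅ :=
    Set.subset_empty_iff.mp <| (Set.inter_subset_inter
      (spectrum_postcomp_subset A) (spectrum_precomp_subset B)).trans h.subset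
  have hbij := bijective_sub_of_commute hcomm hdisj
  exact hbij.existsUnique
end

section
/- Let 𝒳 and 𝒴 be complex Banach spaces, A a bounded linear operator on 𝒳, B an invertible bounded linear operator on 𝒴, and C a bounded linear operator from 𝒴 to 𝒳. Suppose r > 0 satisfies ρ(A) < r and ρ(B⁻¹) < 1/r. Then the operator X = (1/(2πi)) ∮_{|λ|=r} (λ − A)⁻¹ C (λ − B)⁻¹ dλ, given by the integral over the circle of radius r centered at 0, satisfies AX − XB = C. -/
open ContinuousLinearMap Real

/-- A continuous linear map commutes with circle integrals. -/
theorem ContinuousLinearMap.circleIntegral_map_comm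
    {V W : Type*} [NormedAddCommGroup V] [NormedSpace ℂ V] [CompleteSpace V]
    [NormedAddCommGroup W] [NormedSpace ℂ W] [CompleteSpace W]
    (L : V →L[ℂ] W) {f : ℂ → V} {c : ℂ} {R : ℝ} (hf : CircleIntegrable f c R) :
    (∮ z in C(c, R), L (f z)) = L (∮ z in C(c, R), f z) := by
  simp only [circleIntegral, ← L.map_smul]
  exact L.intervalIntegral_comp_comm hf.out

section BanachAlgebra

variable {R : Type*} [NormedRing R] [NormedAlgebra ℂ R]

theorem inverse_smul_one_sub_eq_inv_smul (a : R) {z : ℂ} (hz : z ≠ 0) :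
    Ring.inverse (z • (1 : R) - a) = z⁻¹ • Ring.inverse (1 - z⁻¹ • a) := by
  have h := spectrum.units_smul_resolvent_self (r := Units.mk0 z hz) (a := a)
  simp only [resolvent, Algebra.algebraMap_eq_smul_one, Units.smul_def, Units.val_mk0,
    Units.val_inv_eq_inv_val, one_smul] at h
  rw [← h, inv_smul_smul₀ hz]

theorem isUnit_smul_one_sub_of_spectralRadius_lt {a : R} {r : ℝ}
    (ha : spectralRadius ℂ a < ENNReal.ofReal r) {z : ℂ} (hz : ‖z‖ = r) :
    IsUnit (z • (1 : R) - a) := by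
  rw [← Algebra.algebraMap_eq_smul_one, ← spectrum.mem_resolventSet_iff]
  apply spectrum.mem_resolventSet_of_spectralRadius_lt
  rwa [← hz, ofReal_norm] at ha

theorem differentiableAt_inverse_smul_one_sub [CompleteSpace R] {a : R} {z : ℂ}
    (h : IsUnit (z • (1 : R) - a)) :
    DifferentiableAt ℂ (fun w : ℂ => Ring.inverse (w • (1 : R) - a)) z :=
  (differentiableAt_inverse h).comp z
    ((differentiableAt_id.smul_const (1 : R)).sub_const a)

/-- The Riesz projection over a circle surrounding the whole spectrum is the identity. -/
theorem circleIntegral_resolvent_eq_one [CompleteSpace R] {a : R} {r : ℝ} (hr : 0 < r)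
    (ha : spectralRadius ℂ a < ENNReal.ofReal r) :
    (2 * π * Complex.I)⁻¹ • (∮ z in C(0, r), Ring.inverse (z • (1 : R) - a)) = 1 := by
  set g : ℂ → R := fun w => Ring.inverse (1 - w • a)
  have hr' : ((r⁻¹).toNNReal : ENNReal) < (spectralRadius ℂ a)⁻¹ := by
    rw [ENNReal.lt_inv_iff_lt_inv]
    refine ha.trans_eq ?_
    rw [← ENNReal.ofReal, ENNReal.ofReal_inv_of_pos hr, inv_inv]
  have hg : DiffContOnCl ℂ g (Metric.ball 0 |r⁻¹|) := by
    have hd := spectrum.differentiableOn_inverse_one_sub_smul hr'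
    rw [Real.coe_toNNReal _ (inv_nonneg.2 hr.le)] at hd
    rw [abs_of_pos (inv_pos.2 hr)]
    exact (hd.mono Metric.closure_ball_subset_closedBall).diffContOnCl
  calc
    _ = (2 * π * Complex.I)⁻¹ • (∮ z in C(0, r), (z - 0)⁻¹ • g z⁻¹) := by
      congr 1
      refine circleIntegral.integral_congr hr.le fun z hz => ?_
      have hz0 : z ≠ 0 := ne_zero_of_mem_sphere hr.ne' ⟨z, hz⟩
      simp only [sub_zero]
      exact inverse_smul_one_sub_eq_inv_smul a hz0
    _ = circleAverage (fun z => g z⁻¹) 0 r := (circleAverage_eq_circleIntegral hr.ne').symm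
    _ = circleAverage g 0 r⁻¹ := by
      rw [circleAverage_eq_circleAverage_zero_one,
        circleAverage_eq_circleAverage_zero_one (R := r⁻¹),
        ← circleAverage_zero_one_congr_inv (f := fun z => g (((r⁻¹ : ℝ) : ℂ) * z + 0))]
      simp [mul_comm]
    _ = g 0 := hg.circleAverage
    _ = 1 := by simp [g]

theorem isUnit_smul_one_sub_of_spectralRadius_inverse_lt {b : R} (hb : IsUnit b) {r : ℝ}
    (hr : 0 < r) (hbinv : spectralRadius ℂ (Ring.inverse b) < ENNReal.ofReal (1 / r)) :
    ∀ z ∈ Metric.closedBall (0 : ℂ) r, IsUnit (z • (1 : R) - b) := by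
  intro z hz
  have hu : IsUnit (1 - z • Ring.inverse b) := by
    apply spectrum.isUnit_one_sub_smul_of_lt_inv_radius
    rw [ENNReal.lt_inv_iff_lt_inv]
    refine hbinv.trans_le ?_
    rw [one_div, ENNReal.ofReal_inv_of_pos hr, ENNReal.inv_le_inv, ← enorm_eq_nnnorm,
      ← ofReal_norm]
    exact ENNReal.ofReal_le_ofReal (mem_closedBall_zero_iff.1 hz)
  have h : z • (1 : R) - b = -((1 - z • Ring.inverse b) * b) := by
    rw [sub_mul, smul_mul_assoc, Ring.inverse_mul_cancel b hb, one_mul, neg_sub]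
  rw [h]
  exact (hu.mul hb).neg

end BanachAlgebra

/-- The circle-integral representation of the solution of the Sylvester equation:
if `ρ(A) < r` and `ρ(B⁻¹) < 1/r`, then
`X = (1/(2πi)) ∮_{|λ|=r} (λ - A)⁻¹ C (λ - B)⁻¹ dλ` satisfies `AX - XB = C`. -/
theorem sylvester_circleIntegral_solution
    {E F : Type*} [NormedAddCommGroup E] [NormedSpace ℂ E] [CompleteSpace E]
    [NormedAddCommGroup F] [NormedSpace ℂ F] [CompleteSpace F]
    (A : E →L[ℂ] E) (B : F →L[ℂ] F) (hB : IsUnit B) (C : F →L[ℂ] E)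
    (r : ℝ) (hr : 0 < r)
    (hA : spectralRadius ℂ A < ENNReal.ofReal r)
    (hBinv : spectralRadius ℂ (Ring.inverse B) < ENNReal.ofReal (1 / r)) :
    A ∘L ((2 * π * Complex.I)⁻¹ •
        ∮ z in C(0, r), (Ring.inverse (z • (1 : E →L[ℂ] E) - A)) ∘L C ∘L
          (Ring.inverse (z • (1 : F →L[ℂ] F) - B))) -
      ((2 * π * Complex.I)⁻¹ •
        ∮ z in C(0, r), (Ring.inverse (z • (1 : E →L[ℂ] E) - A)) ∘L C ∘L
          (Ring.inverse (z • (1 : F →L[ℂ] F) - B))) ∘L B = C := by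
  have hUA : ∀ z ∈ Metric.sphere (0 : ℂ) r, IsUnit (z • (1 : E →L[ℂ] E) - A) := fun z hz =>
    isUnit_smul_one_sub_of_spectralRadius_lt hA (mem_sphere_zero_iff_norm.1 hz)
  have hUB := isUnit_smul_one_sub_of_spectralRadius_inverse_lt hB hr hBinv
  set RA : ℂ → E →L[ℂ] E := fun z => Ring.inverse (z • (1 : E →L[ℂ] E) - A)
  set RB : ℂ → F →L[ℂ] F := fun z => Ring.inverse (z • (1 : F →L[ℂ] F) - B)
  have hRA : ContinuousOn RA (Metric.sphere 0 r) := fun z hz =>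
    (differentiableAt_inverse_smul_one_sub (hUA z hz)).continuousAt.continuousWithinAt
  have hRB : ∀ z ∈ Metric.closedBall (0 : ℂ) r, DifferentiableAt ℂ RB z := fun z hz =>
    differentiableAt_inverse_smul_one_sub (hUB z hz)
  have hRBc : ContinuousOn RB (Metric.closedBall 0 r) := fun z hz =>
    (hRB z hz).continuousAt.continuousWithinAt
  have hRBs : ContinuousOn RB (Metric.sphere 0 r) := hRBc.mono Metric.sphere_subset_closedBall
  have hint : CircleIntegrable (fun z => RA z ∘L C ∘L RB z) 0 r :=
    (hRA.clm_comp (continuousOn_const.clm_comp hRBs)).circleIntegrable hr.le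
  have hintB : (∮ z in C(0, r), RB z) = 0 :=
    Complex.circleIntegral_eq_zero_of_differentiable_on_off_countable hr.le
      Set.countable_empty hRBc fun z hz => hRB z (Metric.ball_subset_closedBall hz.1)
  have hintA : (2 * π * Complex.I)⁻¹ • (∮ z in C(0, r), RA z) = 1 :=
    circleIntegral_resolvent_eq_one hr hA
  let preC : (E →L[ℂ] E) →L[ℂ] (F →L[ℂ] E) := (compL ℂ F E E).flip C
  let postC : (F →L[ℂ] F) →L[ℂ] (F →L[ℂ] E) := compL ℂ F F E C
  let L : (F →L[ℂ] E) →L[ℂ] (F →L[ℂ] E) := compL ℂ F E E A - (compL ℂ F F E).flip B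
  have hL : ∀ z ∈ Metric.sphere (0 : ℂ) r,
      L (RA z ∘L C ∘L RB z) = preC (RA z) - postC (RB z) := by
    intro z hz
    have h₁ : A ∘L RA z = z • RA z - 1 := by
      have h := Ring.mul_inverse_cancel _ (hUA z hz)
      rw [sub_mul, smul_mul_assoc, one_mul] at h
      exact eq_sub_of_add_eq (sub_eq_iff_eq_add'.1 h).symm
    have h₂ : RB z ∘L B = z • RB z - 1 := by
      have h := Ring.inverse_mul_cancel _ (hUB z (Metric.sphere_subset_closedBall hz))
      rw [mul_sub, mul_smul_comm, mul_one] at h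
      exact eq_sub_of_add_eq (sub_eq_iff_eq_add'.1 h).symm
    change A ∘L (RA z ∘L (C ∘L RB z)) - (RA z ∘L (C ∘L RB z)) ∘L B = RA z ∘L C - C ∘L RB z
    rw [← comp_assoc A, h₁, comp_assoc, comp_assoc, h₂]
    ext x
    simp
  have hLX : L (∮ z in C(0, r), RA z ∘L C ∘L RB z) = preC (∮ z in C(0, r), RA z) := by
    rw [← L.circleIntegral_map_comm hint, circleIntegral.integral_congr hr.le hL,
      circleIntegral.integral_sub (f := fun z => preC (RA z)) (g := fun z => postC (RB z))
        ((preC.continuous.comp_continuousOn hRA).circleIntegrable hr.le)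
        ((postC.continuous.comp_continuousOn hRBs).circleIntegrable hr.le),
      preC.circleIntegral_map_comm (hRA.circleIntegrable hr.le),
      postC.circleIntegral_map_comm (hRBs.circleIntegrable hr.le), hintB, map_zero, sub_zero]
  change L ((2 * π * Complex.I)⁻¹ • ∮ z in C(0, r), RA z ∘L C ∘L RB z) = C
  rw [L.map_smul, hLX, ← preC.map_smul, hintA]
  exact id_comp C
end

section
/- Let 𝒳 and 𝒴 be complex Banach spaces, A a bounded linear operator on 𝒳, B an invertible bounded linear operator on 𝒴, and C a bounded linear operator from 𝒴 to 𝒳. If ρ(A)·ρ(B⁻¹) < 1, then the series ∑_{n=0}^∞ Aⁿ C B^{-(n+1)} converges (is summable in operator norm), and X = − ∑_{n=0}^∞ Aⁿ C B^{-(n+1)} satisfies AX − XB = C. -/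
open ContinuousLinearMap

open Filter Topology ENNReal NNReal

lemma spectralRadius_ne_top_of_complete {R : Type*} [NormedRing R] [NormedAlgebra ℂ R]
    [CompleteSpace R] (a : R) : spectralRadius ℂ a ≠ ∞ := by
  refine ne_top_of_le_ne_top ?_ (spectrum.spectralRadius_le_pow_nnnorm_pow_one_div ℂ a 0)
  simp [ENNReal.mul_eq_top]

/-- If the product of the spectral radii of `a` and `b` is less than one, then
`‖aⁿ‖ * ‖bⁿ‖` is summable. -/
lemma summable_norm_pow_mul_norm_pow_of_spectralRadius_mul_lt_one
    {R S : Type*} [NormedRing R] [NormedAlgebra ℂ R] [CompleteSpace R]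
    [NormedRing S] [NormedAlgebra ℂ S] [CompleteSpace S] (a : R) (b : S)
    (h : spectralRadius ℂ a * spectralRadius ℂ b < 1) :
    Summable fun n : ℕ => ‖a ^ n‖ * ‖b ^ n‖ := by
  obtain ⟨r, hr, hr1⟩ := ENNReal.lt_iff_exists_nnreal_btwn.mp h
  have hlim := ENNReal.Tendsto.mul
    (spectrum.pow_nnnorm_pow_one_div_tendsto_nhds_spectralRadius a)
    (Or.inr (spectralRadius_ne_top_of_complete b))
    (spectrum.pow_nnnorm_pow_one_div_tendsto_nhds_spectralRadius b)
    (Or.inr (spectralRadius_ne_top_of_complete a))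
  have hbound : ∀ᶠ n : ℕ in atTop, ‖‖a ^ n‖ * ‖b ^ n‖‖ ≤ (r : ℝ) ^ n := by
    filter_upwards [hlim.eventually_lt_const hr, eventually_gt_atTop 0] with n hn hn0
    have hn0' : (0 : ℝ) < n := Nat.cast_pos.mpr hn0
    rw [← ENNReal.mul_rpow_of_nonneg _ _ (by positivity), one_div] at hn
    have hle := (ENNReal.rpow_inv_le_iff hn0').mp hn.le
    rw [ENNReal.rpow_natCast] at hle
    rw [norm_mul, norm_norm, norm_norm]
    exact_mod_cast hle
  exact .of_norm_bounded_eventually_nat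
    (summable_geometric_of_lt_one r.coe_nonneg (by exact_mod_cast hr1)) hbound

/-- If `ρ(A)·ρ(B⁻¹) < 1` then the series `∑ Aⁿ C B^{-(n+1)}` is summable and
`X = -∑ Aⁿ C B^{-(n+1)}` solves the Sylvester equation `AX - XB = C`. -/
theorem sylvester_series_solution
    {E F : Type*} [NormedAddCommGroup E] [NormedSpace ℂ E] [CompleteSpace E]
    [NormedAddCommGroup F] [NormedSpace ℂ F] [CompleteSpace F]
    (A : E →L[ℂ] E) (B : F →L[ℂ] F) (hB : IsUnit B) (C : F →L[ℂ] E)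
    (h : spectralRadius ℂ A * spectralRadius ℂ (Ring.inverse B) < 1) :
    Summable (fun n : ℕ => (A ^ n) ∘L C ∘L (Ring.inverse B) ^ (n + 1)) ∧
      A ∘L (-∑' n : ℕ, (A ^ n) ∘L C ∘L (Ring.inverse B) ^ (n + 1)) -
        (-∑' n : ℕ, (A ^ n) ∘L C ∘L (Ring.inverse B) ^ (n + 1)) ∘L B = C := by
  set D := Ring.inverse B
  have hDB : D ∘L B = .id ℂ F := Ring.inverse_mul_cancel B hB
  have hs : Summable (fun n : ℕ => (A ^ n) ∘L C ∘L D ^ (n + 1)) := by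
    refine .of_norm_bounded
      ((summable_norm_pow_mul_norm_pow_of_spectralRadius_mul_lt_one A D h).mul_left
        (‖C‖ * ‖D‖)) fun n => ?_
    calc ‖(A ^ n) ∘L C ∘L D ^ (n + 1)‖
        ≤ ‖A ^ n‖ * (‖C‖ * (‖D ^ n‖ * ‖D‖)) := by
          refine (opNorm_comp_le _ _).trans ?_
          gcongr
          refine (opNorm_comp_le _ _).trans ?_
          gcongr
          rw [pow_succ]
          exact norm_mul_le _ _
      _ = ‖C‖ * ‖D‖ * (‖A ^ n‖ * ‖D ^ n‖) := by ring
  refine ⟨hs, ?_⟩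
  have hA : A ∘L (∑' n : ℕ, (A ^ n) ∘L C ∘L D ^ (n + 1)) =
      ∑' n : ℕ, (A ^ (n + 1)) ∘L C ∘L D ^ (n + 1) := by
    refine ((compL ℂ F E E A).map_tsum hs).trans (tsum_congr fun n => ?_)
    rw [pow_succ' A]
    rfl
  have hterm (n : ℕ) : ((A ^ n) ∘L C ∘L D ^ (n + 1)) ∘L B = (A ^ n) ∘L C ∘L D ^ n := by
    rw [pow_succ, mul_def, comp_assoc, comp_assoc, comp_assoc, hDB, comp_id]
  have hs' : Summable (fun n : ℕ => (A ^ n) ∘L C ∘L D ^ n) :=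
    (((compL ℂ F F E).flip B).summable hs).congr hterm
  have hXB : (∑' n : ℕ, (A ^ n) ∘L C ∘L D ^ (n + 1)) ∘L B =
      ∑' n : ℕ, (A ^ n) ∘L C ∘L D ^ n :=
    (((compL ℂ F F E).flip B).map_tsum hs).trans (tsum_congr hterm)
  have hzero : (A ^ 0) ∘L C ∘L D ^ 0 = C := by
    ext x
    simp
  rw [comp_neg, neg_comp, hA, hXB, hs'.tsum_eq_zero_add, hzero]
  abel
end

section
/- Let 𝒳 and 𝒴 be complex Banach spaces, A a bounded linear operator on 𝒳, B a bounded linear operator on 𝒴, and C, Y bounded linear operators from 𝒴 to 𝒳. Let p(λ) = ∑_{j=0}^d α_j λʲ be a complex polynomial such that p(A)Y − Y p(B) = C. Then X = q(A,B)(Y) = ∑_{j=1}^d α_j ∑_{i=0}^{j-1} Aⁱ Y B^{j-1-i} satisfies AX − XB = C. -/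
open ContinuousLinearMap Polynomial

theorem comp_sum_pow_sub_sum_pow_comp
    {E F : Type*} [NormedAddCommGroup E] [NormedSpace ℂ E]
    [NormedAddCommGroup F] [NormedSpace ℂ F]
    (A : E →L[ℂ] E) (B : F →L[ℂ] F) (Y : F →L[ℂ] E) (j : ℕ) :
    A ∘L (∑ i ∈ Finset.range j, (A ^ i) ∘L Y ∘L (B ^ (j - 1 - i))) -
      (∑ i ∈ Finset.range j, (A ^ i) ∘L Y ∘L (B ^ (j - 1 - i))) ∘L B =
    (A ^ j) ∘L Y - Y ∘L (B ^ j) := by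
  have telescope := Finset.sum_range_sub (fun i => (A ^ i) ∘L Y ∘L (B ^ (j - i))) j
  have summand (i : ℕ) (hi : i ∈ Finset.range j) :
      A ∘L ((A ^ i) ∘L Y ∘L (B ^ (j - 1 - i))) - ((A ^ i) ∘L Y ∘L (B ^ (j - 1 - i))) ∘L B =
        (A ^ (i + 1)) ∘L Y ∘L (B ^ (j - (i + 1))) - (A ^ i) ∘L Y ∘L (B ^ (j - i)) := by
    have hi := Finset.mem_range.mp hi
    rw [show j - i = j - 1 - i + 1 by lia, show j - (i + 1) = j - 1 - i by lia,
      pow_succ' A, pow_succ B]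
    rfl
  rw [comp_finsetSum, finsetSum_comp, ← Finset.sum_sub_distrib,
    Finset.sum_congr rfl summand, telescope]
  simp [one_def]

/-- **Post-processing.** If `Y` solves the modified Sylvester equation
`p(A) Y - Y p(B) = C`, then `X = q(A,B)(Y) = ∑_j α_j ∑_{i<j} Aⁱ Y B^{j-1-i}`
(with `q(λ,μ) = (p(λ)-p(μ))/(λ-μ)`) solves the original equation `AX - XB = C`. -/
theorem sylvester_post_processing
    {E F : Type*} [NormedAddCommGroup E] [NormedSpace ℂ E] [CompleteSpace E]
    [NormedAddCommGroup F] [NormedSpace ℂ F] [CompleteSpace F]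
    (A : E →L[ℂ] E) (B : F →L[ℂ] F) (C Y : F →L[ℂ] E) (p : Polynomial ℂ)
    (hY : (aeval A p) ∘L Y - Y ∘L (aeval B p) = C) :
    A ∘L (∑ j ∈ Finset.range (p.natDegree + 1), p.coeff j •
        ∑ i ∈ Finset.range j, (A ^ i) ∘L Y ∘L (B ^ (j - 1 - i))) -
      (∑ j ∈ Finset.range (p.natDegree + 1), p.coeff j •
        ∑ i ∈ Finset.range j, (A ^ i) ∘L Y ∘L (B ^ (j - 1 - i))) ∘L B = C := by
  rw [← hY, comp_finsetSum, finsetSum_comp, ← Finset.sum_sub_distrib,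
    aeval_eq_sum_range, aeval_eq_sum_range, comp_finsetSum, finsetSum_comp,
    ← Finset.sum_sub_distrib]
  refine Finset.sum_congr rfl fun j _ => ?_
  simp only [comp_smul, ContinuousLinearMap.smul_comp, ← smul_sub, comp_sum_pow_sub_sum_pow_comp]
end

section
/- Let 𝒳 and 𝒴 be complex Banach spaces, A a bounded linear operator on 𝒳, B a bounded linear operator on 𝒴, and C a bounded linear operator from 𝒴 to 𝒳. Let p(λ) = ∑_{j=0}^d α_j λʲ be a complex polynomial with σ(p(A)) ∩ σ(p(B)) = ∅. Then the equation p(A)X − X p(B) = q(A,B)(C), where q(A,B)(C) = ∑_{j=1}^d α_j ∑_{i=0}^{j-1} Aⁱ C B^{j-1-i}, has a unique solution X among bounded operators from 𝒴 to 𝒳, and this X also satisfies AX − XB = C. -/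
open ContinuousLinearMap Polynomial

/-- In a complex Banach algebra, the difference of two commuting elements with disjoint spectra
is invertible. -/
theorem isUnit_sub_of_commute_of_disjoint_spectrum {M : Type*} [NormedRing M]
    [NormedAlgebra ℂ M] [CompleteSpace M] {a b : M} (hab : Commute a b)
    (h : Disjoint (spectrum ℂ a) (spectrum ℂ b)) : IsUnit (a - b) := by
  let s : Set M := {a, b}
  let K : Subalgebra ℂ M := Subalgebra.centralizer ℂ (Set.centralizer s)
  have hsK : s ⊆ K := Set.subset_centralizer_centralizer
  have hcomm : ∀ x ∈ K, ∀ y ∈ K, x * y = y * x := by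
    apply Set.centralizer_centralizer_comm_of_comm
    rintro x (rfl | rfl) y (rfl | rfl)
    exacts [rfl, hab, hab.symm, rfl]
  have hunit (x : K) (hx : IsUnit (x : M)) : IsUnit x := by
    obtain ⟨u, hu⟩ := hx
    have hu' : (↑u⁻¹ : M) ∈ K := by
      refine Subalgebra.mem_centralizer_iff ℂ |>.2 fun y hy ↦ ?_
      have hyu : Commute y (u : M) := by
        rw [hu]
        exact Subalgebra.mem_centralizer_iff ℂ |>.1 x.2 y hy
      exact hyu.units_inv_right
    refine ⟨⟨x, ⟨_, hu'⟩, ?_, ?_⟩, rfl⟩ <;> ext <;> simp [← hu]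
  have hclosed : IsClosed (K : Set M) := Set.isClosed_centralizer _
  have : CompleteSpace K := hclosed.completeSpace_coe
  let _ : NormedCommRing K :=
    { (inferInstance : NormedRing K) with
      mul_comm := fun x y ↦ Subtype.ext (hcomm x x.2 y y.2) }
  let a' : K := ⟨a, hsK (by simp [s])⟩
  let b' : K := ⟨b, hsK (by simp [s])⟩
  have hspec (x : K) : spectrum ℂ x ⊆ spectrum ℂ (x : M) := fun z hz hzu ↦
    hz (hunit _ hzu)
  suffices IsUnit (a' - b') from this.map K.val
  by_contra hab'
  obtain ⟨φ, hφ⟩ := WeakDual.CharacterSpace.exists_apply_eq_zero hab'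
  have ha : φ a' ∈ spectrum ℂ a := hspec a' (AlgHom.apply_mem_spectrum φ a')
  have hb : φ b' ∈ spectrum ℂ b := hspec b' (AlgHom.apply_mem_spectrum φ b')
  rw [map_sub, sub_eq_zero] at hφ
  exact Set.disjoint_left.1 h ha (hφ ▸ hb)

/-- The difference of two commuting operators with disjoint spectra is bijective. -/
theorem bijective_sub_of_commute_of_disjoint_spectrum {V : Type*} [NormedAddCommGroup V]
    [NormedSpace ℂ V] [CompleteSpace V] {L R : V →L[ℂ] V} (hLR : Commute L R)
    (h : Disjoint (spectrum ℂ L) (spectrum ℂ R)) :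
    Function.Bijective fun v ↦ L v - R v :=
  ContinuousLinearMap.isUnit_iff_bijective.1
    (isUnit_sub_of_commute_of_disjoint_spectrum hLR h)

section Sylvester

variable {E F : Type*} [NormedAddCommGroup E] [NormedSpace ℂ E]
  [NormedAddCommGroup F] [NormedSpace ℂ F]

/-- The spectrum of left composition with `T` is contained in that of `T`. -/
theorem spectrum_compL_subset (T : E →L[ℂ] E) :
    spectrum ℂ (compL ℂ F E E T) ⊆ spectrum ℂ T := by
  intro z hz hu
  obtain ⟨u, hu⟩ := hu
  refine hz ⟨⟨compL ℂ F E E u, compL ℂ F E E ↑u⁻¹, ?_, ?_⟩, ?_⟩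
  · ext X x
    exact DFunLike.congr_fun u.mul_inv (X x)
  · ext X x
    exact DFunLike.congr_fun u.inv_mul (X x)
  · ext X x
    exact DFunLike.congr_fun hu (X x)

/-- The spectrum of right composition with `S` is contained in that of `S`. -/
theorem spectrum_compL_flip_subset (S : F →L[ℂ] F) :
    spectrum ℂ ((compL ℂ F F E).flip S) ⊆ spectrum ℂ S := by
  intro z hz hu
  obtain ⟨u, hu⟩ := hu
  refine hz ⟨⟨(compL ℂ F F E).flip u, (compL ℂ F F E).flip ↑u⁻¹, ?_, ?_⟩, ?_⟩
  · ext X x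
    exact congrArg X (DFunLike.congr_fun u.inv_mul x)
  · ext X x
    exact congrArg X (DFunLike.congr_fun u.mul_inv x)
  · ext X x
    have hx : (u : F →L[ℂ] F) x = z • x - S x := DFunLike.congr_fun hu x
    change X ((u : F →L[ℂ] F) x) = z • X x - X (S x)
    rw [hx, map_sub, map_smul]

/-- **Sylvester–Rosenblum theorem.** If `T` and `S` have disjoint spectra, then
`X ↦ T X - X S` is bijective. -/
theorem bijective_comp_sub_comp [CompleteSpace E] {T : E →L[ℂ] E} {S : F →L[ℂ] F}
    (h : Disjoint (spectrum ℂ T) (spectrum ℂ S)) :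
    Function.Bijective fun X : F →L[ℂ] E ↦ T ∘L X - X ∘L S :=
  bijective_sub_of_commute_of_disjoint_spectrum
    (ContinuousLinearMap.ext fun X ↦ (ContinuousLinearMap.comp_assoc T X S).symm)
    (h.mono (spectrum_compL_subset T) (spectrum_compL_flip_subset S))

theorem comp_aeval_comm (T : E →L[ℂ] E) (p : ℂ[X]) :
    (aeval T p) ∘L T = T ∘L (aeval T p) := by
  have h := (Commute.all p X).map (aeval T : ℂ[X] →ₐ[ℂ] E →L[ℂ] E)
  rwa [aeval_X] at h

/-- The divided difference of `p` at `(A, B)`, applied to `C`, telescopes under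
`Y ↦ A Y - Y B`. -/
theorem comp_dividedDifference_sub (A : E →L[ℂ] E) (B : F →L[ℂ] F) (C : F →L[ℂ] E)
    (p : ℂ[X]) :
    (A ∘L ∑ j ∈ Finset.range (p.natDegree + 1), p.coeff j •
        ∑ i ∈ Finset.range j, (A ^ i) ∘L C ∘L (B ^ (j - 1 - i))) -
      (∑ j ∈ Finset.range (p.natDegree + 1), p.coeff j •
        ∑ i ∈ Finset.range j, (A ^ i) ∘L C ∘L (B ^ (j - 1 - i))) ∘L B =
      (aeval A p) ∘L C - C ∘L (aeval B p) := by
  have hpow (j : ℕ) :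
      (A ∘L ∑ i ∈ Finset.range j, (A ^ i) ∘L C ∘L (B ^ (j - 1 - i))) -
        (∑ i ∈ Finset.range j, (A ^ i) ∘L C ∘L (B ^ (j - 1 - i))) ∘L B =
        (A ^ j) ∘L C - C ∘L (B ^ j) := by
    have htel := Finset.sum_range_sub (fun i ↦ (A ^ i) ∘L C ∘L (B ^ (j - i))) j
    simp only [Nat.sub_self, Nat.sub_zero, pow_zero, one_def, comp_id, id_comp] at htel
    rw [← htel, comp_finsetSum, finsetSum_comp, ← Finset.sum_sub_distrib]
    refine Finset.sum_congr rfl fun i hi ↦ ?_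
    have hij : j - i = j - 1 - i + 1 := by grind
    have hij' : j - (i + 1) = j - 1 - i := by omega
    rw [hij, hij', pow_succ' A, pow_succ B]
    rfl
  rw [aeval_eq_sum_range, aeval_eq_sum_range]
  rw [comp_finsetSum, finsetSum_comp, comp_finsetSum, finsetSum_comp,
    ← Finset.sum_sub_distrib, ← Finset.sum_sub_distrib]
  refine Finset.sum_congr rfl fun j _ ↦ ?_
  rw [comp_smul, comp_smul, ContinuousLinearMap.smul_comp, ContinuousLinearMap.smul_comp,
    ← smul_sub, ← smul_sub, hpow]

end Sylvester

/-- **Pre-processing.** If `σ(p(A)) ∩ σ(p(B)) = ∅`, then the equation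
`p(A) X - X p(B) = q(A,B)(C)` has a unique bounded solution `X`, and this `X` also
satisfies the original Sylvester equation `AX - XB = C`. -/
theorem sylvester_pre_processing
    {E F : Type*} [NormedAddCommGroup E] [NormedSpace ℂ E] [CompleteSpace E]
    [NormedAddCommGroup F] [NormedSpace ℂ F] [CompleteSpace F]
    (A : E →L[ℂ] E) (B : F →L[ℂ] F) (C : F →L[ℂ] E) (p : Polynomial ℂ)
    (hp : spectrum ℂ (aeval A p) ∩ spectrum ℂ (aeval B p) = ∅) :
    (∃! X : F →L[ℂ] E,
        (aeval A p) ∘L X - X ∘L (aeval B p) =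
          ∑ j ∈ Finset.range (p.natDegree + 1), p.coeff j •
            ∑ i ∈ Finset.range j, (A ^ i) ∘L C ∘L (B ^ (j - 1 - i))) ∧
      ∀ X : F →L[ℂ] E,
        (aeval A p) ∘L X - X ∘L (aeval B p) =
          (∑ j ∈ Finset.range (p.natDegree + 1), p.coeff j •
            ∑ i ∈ Finset.range j, (A ^ i) ∘L C ∘L (B ^ (j - 1 - i))) →
        A ∘L X - X ∘L B = C := by
  have hbij := bijective_comp_sub_comp (Set.disjoint_iff_inter_eq_empty.2 hp)
  refine ⟨hbij.existsUnique _, fun X hX ↦ hbij.injective ?_⟩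
  rw [← comp_dividedDifference_sub A B C p, ← hX]
  simp only [comp_sub, ContinuousLinearMap.sub_comp, ← ContinuousLinearMap.comp_assoc, comp_aeval_comm A p]
  simp only [ContinuousLinearMap.comp_assoc, comp_aeval_comm B p]
  abel
end

section
/- Let 𝒳 and 𝒴 be nontrivial complex Banach spaces, A a bounded linear operator on 𝒳 and B a bounded linear operator on 𝒴. Let P denote the set of complex polynomials p of degree ≥ 1 for which p(B) is invertible, and define η(A,B) = inf_{p ∈ P} (‖p(A)‖·‖p(B)⁻¹‖)^{1/deg(p)}. Then η(A,B) = inf_{p ∈ P} (ρ(p(A))·ρ(p(B)⁻¹))^{1/deg(p)}. -/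
open ContinuousLinearMap Polynomial

section SpectralRadius

variable {𝒜 : Type*} [NormedRing 𝒜] [NormedAlgebra ℂ 𝒜] [CompleteSpace 𝒜]

lemma toReal_spectralRadius_le_norm [NormOneClass 𝒜] (a : 𝒜) :
    (spectralRadius ℂ a).toReal ≤ ‖a‖ := by
  have h := ENNReal.toReal_mono ENNReal.coe_ne_top (spectrum.spectralRadius_le_nnnorm (𝕜 := ℂ) a)
  simpa using h

/-- Gelfand's formula, real-valued. -/
lemma tendsto_norm_pow_rpow_toReal_spectralRadius [NormOneClass 𝒜] (a : 𝒜) :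
    Filter.Tendsto (fun n : ℕ => ‖a ^ n‖ ^ (1 / n : ℝ)) Filter.atTop
      (nhds (spectralRadius ℂ a).toReal) := by
  have hfin : spectralRadius ℂ a ≠ ⊤ :=
    ne_top_of_le_ne_top ENNReal.coe_ne_top (spectrum.spectralRadius_le_nnnorm (𝕜 := ℂ) a)
  refine ((ENNReal.tendsto_toReal hfin).comp
    (spectrum.pow_norm_pow_one_div_tendsto_nhds_spectralRadius a)).congr fun n => ?_
  exact ENNReal.toReal_ofReal (by positivity)

end SpectralRadius

/-- The normalized separation quantity `η(A,B)` computed with operator norms equals the one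
computed with spectral radii:
`inf_p (‖p(A)‖·‖p(B)⁻¹‖)^{1/deg p} = inf_p (ρ(p(A))·ρ(p(B)⁻¹))^{1/deg p}`,
the infima being over polynomials `p` of degree at least one with `p(B)` invertible. -/
theorem eta_norm_eq_eta_spectralRadius
    {E F : Type*} [NormedAddCommGroup E] [NormedSpace ℂ E] [CompleteSpace E] [Nontrivial E]
    [NormedAddCommGroup F] [NormedSpace ℂ F] [CompleteSpace F] [Nontrivial F]
    (A : E →L[ℂ] E) (B : F →L[ℂ] F) :
    sInf {x : ℝ | ∃ p : Polynomial ℂ, 1 ≤ p.natDegree ∧ IsUnit (aeval B p) ∧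
        x = (‖aeval A p‖ * ‖Ring.inverse (aeval B p)‖) ^ ((p.natDegree : ℝ)⁻¹)} =
      sInf {x : ℝ | ∃ p : Polynomial ℂ, 1 ≤ p.natDegree ∧ IsUnit (aeval B p) ∧
        x = ((spectralRadius ℂ (aeval A p)).toReal *
          (spectralRadius ℂ (Ring.inverse (aeval B p))).toReal) ^ ((p.natDegree : ℝ)⁻¹)} := by
  set S := {x : ℝ | ∃ p : Polynomial ℂ, 1 ≤ p.natDegree ∧ IsUnit (aeval B p) ∧
        x = (‖aeval A p‖ * ‖Ring.inverse (aeval B p)‖) ^ ((p.natDegree : ℝ)⁻¹)}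
  set T := {x : ℝ | ∃ p : Polynomial ℂ, 1 ≤ p.natDegree ∧ IsUnit (aeval B p) ∧
        x = ((spectralRadius ℂ (aeval A p)).toReal *
          (spectralRadius ℂ (Ring.inverse (aeval B p))).toReal) ^ ((p.natDegree : ℝ)⁻¹)}
  have hSbdd : BddBelow S := ⟨0, by rintro _ ⟨p, -, -, rfl⟩; positivity⟩
  have hTbdd : BddBelow T := ⟨0, by rintro _ ⟨p, -, -, rfl⟩; positivity⟩
  by_cases hP : ∃ p : Polynomial ℂ, 1 ≤ p.natDegree ∧ IsUnit (aeval B p)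
  · obtain ⟨q, hq, hqB⟩ := hP
    apply le_antisymm
    · refine le_csInf ⟨_, q, hq, hqB, rfl⟩ ?_
      rintro _ ⟨p, hp, hpB, rfl⟩
      have hlim := ((tendsto_norm_pow_rpow_toReal_spectralRadius (aeval A p)).mul
        (tendsto_norm_pow_rpow_toReal_spectralRadius (Ring.inverse (aeval B p)))).rpow_const
          (p := (p.natDegree : ℝ)⁻¹) (Or.inr (by positivity))
      refine ge_of_tendsto hlim ?_
      filter_upwards [Filter.eventually_ge_atTop 1] with n hn
      refine csInf_le hSbdd ⟨p ^ n, ?_, ?_, ?_⟩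
      · rw [natDegree_pow]
        exact Nat.mul_pos hn hp
      · rw [map_pow]
        exact hpB.pow n
      · rw [natDegree_pow, map_pow, map_pow, Ring.inverse_pow,
          ← Real.mul_rpow (norm_nonneg _) (norm_nonneg _),
          ← Real.rpow_mul (by positivity), Nat.cast_mul, mul_inv, one_div]
    · refine le_csInf ⟨_, q, hq, hqB, rfl⟩ ?_
      rintro _ ⟨p, hp, hpB, rfl⟩
      refine (csInf_le hTbdd ⟨p, hp, hpB, rfl⟩).trans ?_
      gcongr <;> exact toReal_spectralRadius_le_norm _
  · have hS_empty : S = ∅ :=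
      Set.eq_empty_of_forall_notMem fun x ⟨p, hp, hpB, _⟩ => hP ⟨p, hp, hpB⟩
    have hT_empty : T = ∅ :=
      Set.eq_empty_of_forall_notMem fun x ⟨p, hp, hpB, _⟩ => hP ⟨p, hp, hpB⟩
    rw [hS_empty, hT_empty]
end

section
/- Let 𝒳 and 𝒴 be complex Banach spaces, A a bounded linear operator on 𝒳, B an invertible bounded linear operator on 𝒴, and C a bounded linear operator from 𝒴 to 𝒳, and let M = [[A, C],[0, B]] be the block operator on 𝒳 × 𝒴. Suppose r > 0 satisfies ρ(A) < r and ρ(B⁻¹) < 1/r. Then (1/(2πi)) ∮_{|λ|=r} (λ − M)⁻¹ dλ = [[I, X],[0, 0]], where X is the unique bounded operator from 𝒴 to 𝒳 satisfying AX − XB = C. -/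
open ContinuousLinearMap Real

variable {E F : Type*} [NormedAddCommGroup E] [NormedSpace ℂ E] [CompleteSpace E]
  [NormedAddCommGroup F] [NormedSpace ℂ F] [CompleteSpace F]

/-- The upper-triangular block operator `[[P, Q], [0, R]]` on `E × F`,
acting by `(x, y) ↦ (P x + Q y, R y)`. -/
noncomputable def blockUpper (P : E →L[ℂ] E) (Q : F →L[ℂ] E) (R : F →L[ℂ] F) :
    E × F →L[ℂ] E × F :=
  (P ∘L fst ℂ E F + Q ∘L snd ℂ E F).prod (R ∘L snd ℂ E F)

section CircleIntegral

variable {V W : Type*} [NormedAddCommGroup V] [NormedSpace ℂ V] [CompleteSpace V]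
  [NormedAddCommGroup W] [NormedSpace ℂ W] [CompleteSpace W]

theorem ContinuousLinearMap.circleIntegral_comp_comm (L : V →L[ℂ] W) {f : ℂ → V} {c : ℂ} {r : ℝ}
    (hf : CircleIntegrable f c r) : ∮ z in C(c, r), L (f z) = L (∮ z in C(c, r), f z) := by
  simp only [circleIntegral, ← map_smul]
  exact L.intervalIntegral_comp_comm hf.out

theorem circleIntegral_prodMk {f : ℂ → V} {g : ℂ → W} {c : ℂ} {r : ℝ}
    (hf : CircleIntegrable f c r) (hg : CircleIntegrable g c r) :
    ∮ z in C(c, r), (f z, g z) = (∮ z in C(c, r), f z, ∮ z in C(c, r), g z) := by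
  have hfg : CircleIntegrable (fun z ↦ (f z, g z)) c r :=
    ⟨hf.1.prodMk hg.1, hf.2.prodMk hg.2⟩
  exact Prod.ext ((fst ℂ V W).circleIntegral_comp_comm hfg).symm
    ((snd ℂ V W).circleIntegral_comp_comm hfg).symm

end CircleIntegral

section Resolvent

variable {R : Type*} [NormedRing R] [NormedAlgebra ℂ R]

theorem resolvent_mul_self {a : R} {z : ℂ} (hz : z ∈ resolventSet ℂ a) :
    resolvent a z * a = z • resolvent a z - 1 := by
  have h := Ring.inverse_mul_cancel _ hz
  rw [mul_sub, Algebra.algebraMap_eq_smul_one, mul_smul_comm, mul_one] at h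
  rw [resolvent, Algebra.algebraMap_eq_smul_one]
  exact eq_sub_of_add_eq (sub_eq_iff_eq_add'.1 h).symm

theorem self_mul_resolvent {a : R} {z : ℂ} (hz : z ∈ resolventSet ℂ a) :
    a * resolvent a z = z • resolvent a z - 1 := by
  have h := Ring.mul_inverse_cancel _ hz
  rw [sub_mul, Algebra.algebraMap_eq_smul_one, smul_mul_assoc, one_mul] at h
  rw [resolvent, Algebra.algebraMap_eq_smul_one]
  exact eq_sub_of_add_eq (sub_eq_iff_eq_add'.1 h).symm

theorem mem_resolventSet_of_spectralRadius_lt_ofReal {a : R} {r : ℝ}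
    (ha : spectralRadius ℂ a < ENNReal.ofReal r) {z : ℂ} (hz : r ≤ ‖z‖) :
    z ∈ resolventSet ℂ a := by
  refine spectrum.mem_resolventSet_of_spectralRadius_lt (ha.trans_le ?_)
  rw [← enorm_eq_nnnorm, ← ofReal_norm]
  exact ENNReal.ofReal_le_ofReal hz

theorem mem_resolventSet_of_spectralRadius_inverse_lt {b : R} (hb : IsUnit b) {r : ℝ}
    (h : spectralRadius ℂ (Ring.inverse b) < ENNReal.ofReal (1 / r)) {z : ℂ}
    (hz : ‖z‖ ≤ r) : z ∈ resolventSet ℂ b := by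
  obtain ⟨u, rfl⟩ := hb
  rcases eq_or_ne z 0 with rfl | hz0
  · exact spectrum.zero_mem_resolventSet_of_unit u
  · rw [Ring.inverse_unit] at h
    have hinv : ((Units.mk0 z hz0)⁻¹ : ℂˣ).val ∈ resolventSet ℂ ((u⁻¹ : Rˣ) : R) := by
      refine mem_resolventSet_of_spectralRadius_lt_ofReal h ?_
      rw [Units.val_inv_eq_inv_val, Units.val_mk0, norm_inv, one_div]
      exact inv_anti₀ (norm_pos_iff.2 hz0) hz
    simpa using spectrum.inv_mem_resolventSet hinv

variable [CompleteSpace R]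

theorem continuousOn_resolvent {a : R} {s : Set ℂ} (hs : ∀ z ∈ s, z ∈ resolventSet ℂ a) :
    ContinuousOn (resolvent a) s := fun z hz ↦
  (spectrum.hasDerivAt_resolvent_const_left (hs z hz)).continuousAt.continuousWithinAt

theorem circleIntegral_resolvent_eq_zero {b : R} {r : ℝ} (hr : 0 ≤ r)
    (hb : ∀ z : ℂ, ‖z‖ ≤ r → z ∈ resolventSet ℂ b) :
    ∮ z in C(0, r), resolvent b z = 0 :=
  Complex.circleIntegral_eq_zero_of_differentiable_on_off_countable hr Set.countable_empty
    (continuousOn_resolvent fun z hz ↦ hb z (mem_closedBall_zero_iff.1 hz))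
    fun z hz ↦ (spectrum.hasDerivAt_resolvent_const_left
      (hb z (mem_ball_zero_iff.1 hz.1).le)).differentiableAt

theorem circleIntegral_inv_smul_resolvent_eq_zero {a : R} {r : ℝ} (hr : 0 < r)
    (ha : ∀ z : ℂ, r ≤ ‖z‖ → z ∈ resolventSet ℂ a) :
    ∮ z in C(0, r), z⁻¹ • resolvent a z = 0 := by
  have hann (S : ℝ) (hS : r ≤ S) :
      ∮ z in C(0, S), z⁻¹ • resolvent a z = ∮ z in C(0, r), z⁻¹ • resolvent a z := by
    simpa using
      Complex.circleIntegral_sub_center_inv_smul_eq_of_differentiable_on_annulus_off_countable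
        (c := 0) hr hS Set.countable_empty
        (continuousOn_resolvent fun z hz ↦ ha z (by simpa using hz.2))
        fun z hz ↦ (spectrum.hasDerivAt_resolvent_const_left
          (ha z (by simpa using (not_le.1 (mt mem_closedBall_zero_iff.2 hz.1.2)).le))
          ).differentiableAt
  rw [← norm_le_zero_iff]
  refine le_of_forall_pos_le_add fun ε hε ↦ ?_
  have hδ : 0 < ε / (2 * π) := by positivity
  have hev := (spectrum.resolvent_tendsto_cobounded (𝕜 := ℂ) a).norm.eventually
    (ge_mem_nhds (by simpa using hδ))
  obtain ⟨S, -, hS⟩ := (Filter.hasBasis_cobounded_norm (E := ℂ)).eventually_iff.1 hev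
  have hpos : 0 < max r S := hr.trans_le (le_max_left _ _)
  rw [← hann (max r S) (le_max_left _ _), zero_add]
  calc _ ≤ 2 * π * max r S * ((max r S)⁻¹ * (ε / (2 * π))) := by
        refine circleIntegral.norm_integral_le_of_norm_le_const hpos.le fun z hz ↦ ?_
        rw [mem_sphere_zero_iff_norm] at hz
        rw [norm_smul, norm_inv, hz]
        gcongr
        exact hS (show S ≤ ‖z‖ from hz ▸ le_max_right _ _)
    _ = ε := by field_simp

theorem circleIntegral_resolvent_eq_smul_one {a : R} {r : ℝ} (hr : 0 < r)
    (ha : ∀ z : ℂ, r ≤ ‖z‖ → z ∈ resolventSet ℂ a) :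
    ∮ z in C(0, r), resolvent a z = (2 * π * Complex.I : ℂ) • (1 : R) := by
  have hs (z : ℂ) (hz : z ∈ Metric.sphere (0 : ℂ) r) : z ∈ resolventSet ℂ a ∧ z ≠ 0 := by
    rw [mem_sphere_zero_iff_norm] at hz
    exact ⟨ha z hz.ge, norm_pos_iff.1 (hz ▸ hr)⟩
  have hinv : ContinuousOn (fun z : ℂ ↦ z⁻¹) (Metric.sphere (0 : ℂ) r) :=
    continuousOn_inv₀.mono fun z hz ↦ (hs z hz).2
  have hres : ContinuousOn (fun z : ℂ ↦ z⁻¹ • resolvent a z) (Metric.sphere (0 : ℂ) r) :=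
    hinv.smul (continuousOn_resolvent fun z hz ↦ (hs z hz).1)
  have heq : Set.EqOn (resolvent a) (fun z : ℂ ↦ z⁻¹ • (1 : R) + a * (z⁻¹ • resolvent a z))
      (Metric.sphere (0 : ℂ) r) := fun z hz ↦ by
    simp only [mul_smul_comm, self_mul_resolvent (hs z hz).1, smul_sub,
      inv_smul_smul₀ (hs z hz).2, add_sub_cancel]
  have hmul := (ContinuousLinearMap.mul ℂ R a).circleIntegral_comp_comm
    (hres.circleIntegrable hr.le)
  simp only [mul_apply', circleIntegral_inv_smul_resolvent_eq_zero hr ha, mul_zero] at hmul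
  rw [circleIntegral.integral_congr hr.le heq, circleIntegral.integral_add
    (f := fun z : ℂ ↦ z⁻¹ • (1 : R)) (g := fun z : ℂ ↦ a * (z⁻¹ • resolvent a z))
    ((hinv.smul continuousOn_const).circleIntegrable hr.le)
    ((continuousOn_const.mul hres).circleIntegrable hr.le), hmul, add_zero,
    circleIntegral.integral_smul_const]
  congr 1
  simpa using circleIntegral.integral_sub_center_inv 0 hr.ne'

end Resolvent

section Block

omit [CompleteSpace E] [CompleteSpace F]

theorem sylvester_resolvent_comp_comp_resolvent {A : E →L[ℂ] E} {B : F →L[ℂ] F} {z : ℂ}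
    (hA : z ∈ resolventSet ℂ A) (hB : z ∈ resolventSet ℂ B) (C : F →L[ℂ] E) :
    A ∘L (resolvent A z ∘L C ∘L resolvent B z) - (resolvent A z ∘L C ∘L resolvent B z) ∘L B =
      resolvent A z ∘L C - C ∘L resolvent B z := by
  have h₁ (x : E) := DFunLike.congr_fun (self_mul_resolvent hA) x
  have h₂ (y : F) := DFunLike.congr_fun (resolvent_mul_self hB) y
  simp only [mul_apply_eq_comp, sub_apply, smul_apply, one_apply_eq_self] at h₁ h₂
  ext y
  simp [h₁, h₂]

theorem resolvent_comp_comp_resolvent_of_sylvester {A : E →L[ℂ] E} {B : F →L[ℂ] F} {z : ℂ}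
    (hA : z ∈ resolventSet ℂ A) (hB : z ∈ resolventSet ℂ B) {C X : F →L[ℂ] E}
    (h : A ∘L X - X ∘L B = C) :
    resolvent A z ∘L C ∘L resolvent B z = resolvent A z ∘L X - X ∘L resolvent B z := by
  have h₁ (x : E) := DFunLike.congr_fun (resolvent_mul_self hA) x
  have h₂ (y : F) := DFunLike.congr_fun (self_mul_resolvent hB) y
  simp only [mul_apply_eq_comp, sub_apply, smul_apply, one_apply_eq_self] at h₁ h₂
  subst h
  ext y
  simp [h₁, h₂]

theorem inverse_smul_one_sub_blockUpper {A : E →L[ℂ] E} {B : F →L[ℂ] F} {z : ℂ}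
    (hA : z ∈ resolventSet ℂ A) (hB : z ∈ resolventSet ℂ B) (C : F →L[ℂ] E) :
    Ring.inverse (z • (1 : E × F →L[ℂ] E × F) - blockUpper A C B) =
      blockUpper (resolvent A z) (resolvent A z ∘L C ∘L resolvent B z) (resolvent B z) := by
  have h₁ (x : E) := DFunLike.congr_fun (resolvent_mul_self hA) x
  have h₂ (y : F) := DFunLike.congr_fun (resolvent_mul_self hB) y
  have h₃ (x : E) := DFunLike.congr_fun (self_mul_resolvent hA) x
  have h₄ (y : F) := DFunLike.congr_fun (self_mul_resolvent hB) y
  simp only [mul_apply_eq_comp, sub_apply, smul_apply, one_apply_eq_self] at h₁ h₂ h₃ h₄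
  refine Ring.inverse_unit ⟨z • 1 - blockUpper A C B, _, ?_, ?_⟩
  all_goals
    refine ContinuousLinearMap.ext fun p ↦ Prod.ext ?_ ?_ <;>
      simp [blockUpper, h₁, h₂, h₃, h₄, smul_add]
    all_goals abel

/-- `blockUpper` as a continuous linear map of its three blocks. -/
noncomputable def blockUpperL :
    (E →L[ℂ] E) × (F →L[ℂ] E) × (F →L[ℂ] F) →L[ℂ] (E × F →L[ℂ] E × F) where
  toFun p := blockUpper p.1 p.2.1 p.2.2
  map_add' p q := by
    refine ContinuousLinearMap.ext fun x ↦ Prod.ext ?_ ?_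
    · simp only [blockUpper, Prod.fst_add, Prod.snd_add, add_comp, prod_apply, add_apply,
        comp_apply, coe_fst', coe_snd']
      abel
    · simp [blockUpper]
  map_smul' c p := by
    refine ContinuousLinearMap.ext fun x ↦ Prod.ext ?_ ?_ <;> simp [blockUpper, smul_add]
  cont := by
    unfold blockUpper
    exact (prodₗᵢ ℂ).continuous.comp
      (((continuous_fst.clm_comp continuous_const).add
        (continuous_snd.fst.clm_comp continuous_const)).prodMk
        (continuous_snd.snd.clm_comp continuous_const))

end Block

/-- For `M = [[A, C], [0, B]]`, if `ρ(A) < r` and `ρ(B⁻¹) < 1/r` then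
`(1/(2πi)) ∮_{|λ|=r} (λ - M)⁻¹ dλ = [[I, X], [0, 0]]`, where `X` is the unique bounded
solution of the Sylvester equation `AX - XB = C`. -/
theorem circleIntegral_resolvent_block
    (A : E →L[ℂ] E) (B : F →L[ℂ] F) (hB : IsUnit B) (C : F →L[ℂ] E)
    (r : ℝ) (hr : 0 < r)
    (hA : spectralRadius ℂ A < ENNReal.ofReal r)
    (hBinv : spectralRadius ℂ (Ring.inverse B) < ENNReal.ofReal (1 / r)) :
    ∃ X : F →L[ℂ] E,
      (∀ X' : F →L[ℂ] E, A ∘L X' - X' ∘L B = C ↔ X' = X) ∧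
      (2 * π * Complex.I)⁻¹ •
          (∮ z in C(0, r),
            Ring.inverse (z • (1 : E × F →L[ℂ] E × F) - blockUpper A C B)) =
        blockUpper 1 X 0 := by
  obtain ⟨hrA, hrB⟩ : (∀ z : ℂ, r ≤ ‖z‖ → z ∈ resolventSet ℂ A) ∧
      (∀ z : ℂ, ‖z‖ ≤ r → z ∈ resolventSet ℂ B) :=
    ⟨fun z hz ↦ mem_resolventSet_of_spectralRadius_lt_ofReal hA hz,
      fun z hz ↦ mem_resolventSet_of_spectralRadius_inverse_lt hB hBinv hz⟩
  have hrA' (z : ℂ) (hz : z ∈ Metric.sphere (0 : ℂ) r) : z ∈ resolventSet ℂ A :=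
    hrA z (mem_sphere_zero_iff_norm.1 hz).ge
  have hrB' (z : ℂ) (hz : z ∈ Metric.sphere (0 : ℂ) r) : z ∈ resolventSet ℂ B :=
    hrB z (mem_sphere_zero_iff_norm.1 hz).le
  have hpi : (2 * π * Complex.I : ℂ) ≠ 0 := Complex.two_pi_I_ne_zero
  have intA : ∮ z in C(0, r), resolvent A z = (2 * π * Complex.I : ℂ) • 1 :=
    circleIntegral_resolvent_eq_smul_one hr hrA
  have intB : ∮ z in C(0, r), resolvent B z = 0 :=
    circleIntegral_resolvent_eq_zero hr.le hrB
  have contA : ContinuousOn (resolvent A) (Metric.sphere (0 : ℂ) r) :=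
    continuousOn_resolvent hrA'
  have contB : ContinuousOn (resolvent B) (Metric.sphere (0 : ℂ) r) :=
    continuousOn_resolvent hrB'
  have contT : ContinuousOn (fun z : ℂ ↦ resolvent A z ∘L C ∘L resolvent B z)
      (Metric.sphere (0 : ℂ) r) :=
    contA.clm_comp (continuousOn_const.clm_comp contB)
  have integral_sub_comp (D : F →L[ℂ] E) :
      ∮ z in C(0, r), (resolvent A z ∘L D - D ∘L resolvent B z) =
        (2 * π * Complex.I : ℂ) • D := by
    rw [circleIntegral.integral_sub
      ((contA.clm_comp continuousOn_const).circleIntegrable hr.le)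
      ((continuousOn_const.clm_comp contB).circleIntegrable hr.le)]
    have h₁ := ((compL ℂ F E E).flip D).circleIntegral_comp_comm (contA.circleIntegrable hr.le)
    have h₂ := (compL ℂ F F E D).circleIntegral_comp_comm (contB.circleIntegrable hr.le)
    simp only [flip_apply, compL_apply, intA, intB] at h₁ h₂
    rw [h₁, h₂]
    ext x
    simp
  set T := ∮ z in C(0, r), resolvent A z ∘L C ∘L resolvent B z with hT
  refine ⟨(2 * π * Complex.I : ℂ)⁻¹ • T, fun X' ↦ ⟨fun h ↦ ?_, ?_⟩, ?_⟩
  · rw [eq_inv_smul_iff₀ hpi, ← integral_sub_comp, hT]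
    refine circleIntegral.integral_congr hr.le fun z hz ↦ ?_
    exact (resolvent_comp_comp_resolvent_of_sylvester (hrA' z hz) (hrB' z hz) h).symm
  · rintro rfl
    have h := (compL ℂ F E E A - (compL ℂ F F E).flip B).circleIntegral_comp_comm
      (contT.circleIntegrable hr.le)
    simp only [sub_apply, flip_apply, compL_apply] at h
    rw [comp_smul, smul_comp, ← smul_sub, ← h, inv_smul_eq_iff₀ hpi, ← integral_sub_comp]
    exact circleIntegral.integral_congr hr.le fun z hz ↦
      sylvester_resolvent_comp_comp_resolvent (hrA' z hz) (hrB' z hz) C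
  · have hblock : Set.EqOn
        (fun z : ℂ ↦ Ring.inverse (z • (1 : E × F →L[ℂ] E × F) - blockUpper A C B))
        (fun z : ℂ ↦ blockUpperL
          (resolvent A z, resolvent A z ∘L C ∘L resolvent B z, resolvent B z))
        (Metric.sphere (0 : ℂ) r) :=
      fun z hz ↦ inverse_smul_one_sub_blockUpper (hrA' z hz) (hrB' z hz) C
    rw [circleIntegral.integral_congr hr.le hblock, blockUpperL.circleIntegral_comp_comm
      ((contA.prodMk (contT.prodMk contB)).circleIntegrable hr.le),
      circleIntegral_prodMk (contA.circleIntegrable hr.le)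
        ((contT.prodMk contB).circleIntegrable hr.le),
      circleIntegral_prodMk (contT.circleIntegrable hr.le) (contB.circleIntegrable hr.le),
      intA, intB, ← map_smul, Prod.smul_mk, inv_smul_smul₀ hpi, Prod.smul_mk, smul_zero]
    rfl
end
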